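/- arXiv:1711.00321 — 5 statements merged into one kernel-verified Lean document; each statement's English description precedes it below -/
import Mathlib

section
/- Let n ≥ 1, let e : ℝ → ℝ be smooth, let ρ : ℝ × ℝⁿ → ℝ be smooth with ρ > 0 everywhere, and let θ : ℝ × ℝⁿ → ℝ be smooth. Suppose that ∂ₜθ + (1/2)|∇θ|² + e(ρ) + e'(ρ)ρ = 0 and ∂ₜρ + div(ρ ∇θ) = 0 at every point. Then the vector field u := ∇θ and the density ρ satisfy the compressible barotropic Euler equations ∂ₜu + (u·∇)u + (1/ρ) ∇(P∘ρ) = 0 and ∂ₜρ + div(ρ u) = 0 at every point, where the pressure function is P(s) := e'(s) s². -/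
noncomputable section

open MeasureTheory Complex
open scoped ContDiff RealInnerProductSpace

/-- Euclidean space `ℝⁿ`. -/
abbrev En (n : ℕ) : Type := EuclideanSpace ℝ (Fin n)

/-- The `i`-th standard basis vector of `ℝⁿ`. -/
def ee {n : ℕ} (i : Fin n) : En n := EuclideanSpace.single i 1

/-- Laplacian of a real-valued function on `ℝⁿ` (trace of the Hessian). -/
def lapR {n : ℕ} (f : En n → ℝ) (x : En n) : ℝ :=
  ∑ i, fderiv ℝ (fun y => fderiv ℝ f y (ee i)) x (ee i)

/-- Laplacian of a complex-valued function on `ℝⁿ`. -/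
def lapC {n : ℕ} (f : En n → ℂ) (x : En n) : ℂ :=
  ∑ i, fderiv ℝ (fun y => fderiv ℝ f y (ee i)) x (ee i)

/-- Divergence of a vector field on `ℝⁿ`. -/
def dvg {n : ℕ} (v : En n → En n) (x : En n) : ℝ :=
  ∑ i, fderiv ℝ v x (ee i) i

/-- Jacobian matrix of a map `ℝⁿ → ℝⁿ`. -/
def jac {n : ℕ} (φ : En n → En n) (x : En n) : Matrix (Fin n) (Fin n) ℝ :=
  fun i j => fderiv ℝ φ x (ee j) i

section SliceCalculus

variable {E : Type*} [NormedAddCommGroup E] [InnerProductSpace ℝ E]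

lemma hasFDerivAt_slice {F : Type*} [NormedAddCommGroup F] [NormedSpace ℝ F]
    {f : ℝ × E → F} {f' : ℝ × E →L[ℝ] F} {t : ℝ} {x : E} (hf : HasFDerivAt f f' (t, x)) :
    HasFDerivAt (fun y => f (t, y)) (f'.comp (.inr ℝ ℝ E)) x :=
  hf.comp x (hasFDerivAt_prodMk_right t x)

lemma hasDerivAt_slice {F : Type*} [NormedAddCommGroup F] [NormedSpace ℝ F]
    {f : ℝ × E → F} {f' : ℝ × E →L[ℝ] F} {t : ℝ} {x : E} (hf : HasFDerivAt f f' (t, x)) :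
    HasDerivAt (fun s => f (s, x)) (f' (1, 0)) t := by
  have h := (hf.comp t (hasFDerivAt_prodMk_left t x)).hasDerivAt
  simpa [Function.comp_def] using h

variable [CompleteSpace E]

lemma inner_gradient_eq_fderiv (g : E → ℝ) (x v : E) :
    inner ℝ (gradient g x) v = fderiv ℝ g x v :=
  InnerProductSpace.toDual_symm_apply

/-- The spatial gradient is jointly differentiable in time and space, and its derivative is
represented by the second derivative. -/
lemma exists_hasFDerivAt_gradient_slice {θ : ℝ → E → ℝ}
    (hθ : ContDiff ℝ ∞ (Function.uncurry θ)) (p : ℝ × E) :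
    ∃ L : ℝ × E →L[ℝ] E, HasFDerivAt (fun q : ℝ × E => gradient (θ q.1) q.2) L p ∧
      ∀ q v, inner ℝ (L q) v = fderiv ℝ (fderiv ℝ (Function.uncurry θ)) p q (0, v) := by
  have hd : HasFDerivAt (fderiv ℝ (Function.uncurry θ))
      (fderiv ℝ (fderiv ℝ (Function.uncurry θ)) p) p :=
    (((hθ.fderiv_right (m := ∞) (by simp)).differentiable (by simp)) p).hasFDerivAt
  let R : (ℝ × E →L[ℝ] ℝ) →L[ℝ] E :=
    { toFun := fun ℓ => (InnerProductSpace.toDual ℝ E).symm (ℓ.comp (.inr ℝ ℝ E))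
      map_add' := fun _ _ => by simp
      map_smul' := fun _ _ => by simp
      cont := (InnerProductSpace.toDual ℝ E).symm.continuous.comp
        (continuous_id.clm_comp continuous_const) }
  have hR : ∀ (ℓ : ℝ × E →L[ℝ] ℝ) (v : E), inner ℝ (R ℓ) v = ℓ (0, v) := fun ℓ v =>
    InnerProductSpace.toDual_symm_apply
  have hgrad : (fun q : ℝ × E => gradient (θ q.1) q.2) =
      fun q => R (fderiv ℝ (Function.uncurry θ) q) := by
    funext q
    refine ext_inner_right ℝ fun v => ?_
    rw [hR, inner_gradient_eq_fderiv]
    have h := hasFDerivAt_slice (t := q.1) (x := q.2)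
      ((hθ.differentiable (by simp)) q).hasFDerivAt
    have h' : fderiv ℝ (θ q.1) q.2 = _ := h.fderiv
    rw [h']
    simp
  refine ⟨R.comp (fderiv ℝ (fderiv ℝ (Function.uncurry θ)) p), ?_, fun q v => hR _ _⟩
  rw [hgrad]
  exact @HasFDerivAt.comp ℝ _ (ℝ × E) _ _ (ℝ × E →L[ℝ] ℝ) _ _ E _ _ _ _ p _ _ R.hasFDerivAt hd

end SliceCalculus

/-- solutions of the Hamilton–Jacobi system on densities with potential
`∫ e(ρ)ρ` are potential solutions of the compressible barotropic Euler equations with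
pressure `P(s) = e'(s)s²`. -/
theorem barotropic_potential_solutions
    (n : ℕ) (hn : 1 ≤ n)
    (e : ℝ → ℝ) (he : ContDiff ℝ ∞ e)
    (ρ θ : ℝ → En n → ℝ)
    (hρ : ContDiff ℝ ∞ (Function.uncurry ρ))
    (hθ : ContDiff ℝ ∞ (Function.uncurry θ))
    (hρpos : ∀ t x, 0 < ρ t x)
    (hHJ : ∀ t x, deriv (fun s => θ s x) t + (1 / 2) * ‖gradient (θ t) x‖ ^ 2
        + e (ρ t x) + deriv e (ρ t x) * ρ t x = 0)
    (hcont : ∀ t x, deriv (fun s => ρ s x) t + dvg (fun y => ρ t y • gradient (θ t) y) x = 0) :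
    ∀ t x,
      (deriv (fun s => gradient (θ s) x) t
          + fderiv ℝ (fun y => gradient (θ t) y) x (gradient (θ t) x)
          + (ρ t x)⁻¹ • gradient (fun y => deriv e (ρ t y) * (ρ t y) ^ 2) x = 0)
      ∧ deriv (fun s => ρ s x) t + dvg (fun y => ρ t y • gradient (θ t) y) x = 0 := by
  intro t x
  refine ⟨?_, hcont t x⟩
  set D := fderiv ℝ (Function.uncurry θ)
  obtain ⟨L, hL, hLv⟩ := exists_hasFDerivAt_gradient_slice hθ (t, x)
  have hdt : HasDerivAt (fun s => gradient (θ s) x) (L (1, 0)) t := hasDerivAt_slice hL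
  have hdx : HasFDerivAt (fun y => gradient (θ t) y) (L.comp (.inr ℝ ℝ (En n))) x :=
    hasFDerivAt_slice hL
  have hD2 : HasFDerivAt D (fderiv ℝ D (t, x)) (t, x) :=
    (((hθ.fderiv_right (m := ∞) (by simp)).differentiable (by simp)) _).hasFDerivAt
  have hsymm : ∀ a b, fderiv ℝ D (t, x) a b = fderiv ℝ D (t, x) b a :=
    (hθ.contDiffAt.isSymmSndFDerivAt
      (by simpa using WithTop.coe_le_coe.2 (le_top : (2 : ℕ∞) ≤ ⊤))).eq
  have hθt : ∀ y, deriv (fun s => θ s y) t = D (t, y) (1, 0) := fun y =>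
    (hasDerivAt_slice ((hθ.differentiable (by simp)) (t, y)).hasFDerivAt).deriv
  have hρx : HasFDerivAt (ρ t) (fderiv ℝ (ρ t) x) x :=
    (hasFDerivAt_slice ((hρ.differentiable (by simp)) (t, x)).hasFDerivAt).differentiableAt
      |>.hasFDerivAt
  have he1 : HasDerivAt e (deriv e (ρ t x)) (ρ t x) :=
    ((he.differentiable (by simp)) _).hasDerivAt
  have he2 : HasDerivAt (deriv e) (deriv (deriv e) (ρ t x)) (ρ t x) :=
    (((contDiff_infty_iff_deriv.1 he).2.differentiable (by simp)) _).hasDerivAt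
  have he1ρ := he1.comp_hasFDerivAt x hρx
  have he2ρ := he2.comp_hasFDerivAt x hρx
  have hHJx := ((((hasFDerivAt_slice hD2).clm_apply
    (hasFDerivAt_const ((1, 0) : ℝ × En n) x)).add
      (hdx.norm_sq.const_mul (1 / 2))).add he1ρ).add (he2ρ.mul hρx)
  have hP := he2ρ.mul (hρx.pow 2)
  have hzero := hHJx.unique ((hasFDerivAt_const (0 : ℝ) x).congr_of_eventuallyEq
    (Filter.Eventually.of_forall fun y => by simpa [hθt] using hHJ t y))
  refine ext_inner_right ℝ fun v => ?_
  have hv := DFunLike.congr_fun hzero v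
  have hPv : fderiv ℝ (fun y => deriv e (ρ t y) * (ρ t y) ^ 2) x v = _ :=
    DFunLike.congr_fun hP.fderiv v
  have h1 := hsymm (1, 0) (0, v)
  have h2 := hsymm (0, gradient (θ t) x) (0, v)
  have h3 := hLv (0, v) (gradient (θ t) x)
  have hne := (hρpos t x).ne'
  rw [hdt.deriv, hdx.fderiv, inner_add_left, inner_add_left, real_inner_smul_left,
    inner_gradient_eq_fderiv, hPv, inner_zero_left, hLv]
  rw [real_inner_comm] at h3
  simp [hLv] at hv h3 ⊢
  rw [h1, h2, ← h3]
  field_simp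
  linear_combination hv
end
end

section
/- Let n ≥ 1 and let φ : ℝ × ℝⁿ → ℝⁿ and u : ℝ × ℝⁿ → ℝⁿ be smooth maps such that ∂ₜφ(t,x) = u(t, φ(t,x)) for all (t,x). Then for all (t,x), ∂ₜ ( det D_xφ(t,x) ) = (div u)(t, φ(t,x)) · det D_xφ(t,x), where D_xφ is the spatial Jacobian matrix of φ and div u is the spatial divergence of u. -/
noncomputable section

open MeasureTheory Complex
open scoped ContDiff RealInnerProductSpace

/-- Jacobi's formula in row form: the derivative of a determinant is the sum of the determinants
obtained by differentiating one row at a time. -/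
theorem hasDerivAt_det_sum_updateRow {ι : Type*} [Fintype ι] [DecidableEq ι]
    {M : ℝ → Matrix ι ι ℝ} {M' : Matrix ι ι ℝ} {t : ℝ}
    (h : ∀ i j, HasDerivAt (fun s => M s i j) (M' i j) t) :
    HasDerivAt (fun s => (M s).det) (∑ i, ((M t).updateRow i (M' i)).det) t := by
  let D : ContinuousMultilinearMap ℝ (fun _ : ι => ι → ℝ) ℝ :=
    { toMultilinearMap := (Matrix.detRowAlternating (n := ι) (R := ℝ)).toMultilinearMap
      cont := Continuous.matrix_det (A := fun A : Matrix ι ι ℝ => A) continuous_id }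
  have hM : HasDerivAt (fun s i => M s i) (fun i => M' i) t :=
    hasDerivAt_pi.2 fun i => hasDerivAt_pi.2 fun j => h i j
  have key := (D.hasFDerivAt (fun i => M t i)).comp_hasDerivAt t hM
  rw [ContinuousMultilinearMap.linearDeriv_apply] at key
  exact key

/-- Liouville's formula for a matrix solution of the linear equation `M' = A M`. -/
theorem hasDerivAt_det_of_linear {ι : Type*} [Fintype ι] [DecidableEq ι]
    {M : ℝ → Matrix ι ι ℝ} {A : Matrix ι ι ℝ} {t : ℝ}
    (h : ∀ i j, HasDerivAt (fun s => M s i j) ((A * M t) i j) t) :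
    HasDerivAt (fun s => (M s).det) (A.trace * (M t).det) t := by
  convert hasDerivAt_det_sum_updateRow h using 1
  rw [Matrix.trace, Finset.sum_mul]
  refine Finset.sum_congr rfl fun i _ => ?_
  have hrow : (A * M t) i = ∑ k, A i k • M t k := by
    ext j
    simp [Matrix.mul_apply]
  rw [hrow, Matrix.det_updateRow_sum, Matrix.diag_apply, smul_eq_mul]

section PartialDerivatives

variable {E F : Type*} [NormedAddCommGroup E] [NormedSpace ℝ E]
  [NormedAddCommGroup F] [NormedSpace ℝ F]

theorem fderiv_eq_fderiv_uncurry {φ : ℝ → E → F}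
    (hφ : Differentiable ℝ (Function.uncurry φ)) (t : ℝ) (x v : E) :
    fderiv ℝ (φ t) x v = fderiv ℝ (Function.uncurry φ) (t, x) (0, v) := by
  have h := (hφ (t, x)).hasFDerivAt.comp x (hasFDerivAt_prodMk_right t x)
  have h' : fderiv ℝ (φ t) x = _ := h.fderiv
  simp [h']

theorem deriv_eq_fderiv_uncurry {φ : ℝ → E → F}
    (hφ : Differentiable ℝ (Function.uncurry φ)) (t : ℝ) (x : E) :
    deriv (fun s => φ s x) t = fderiv ℝ (Function.uncurry φ) (t, x) (1, 0) := by
  have h := (hφ (t, x)).hasFDerivAt.comp_hasDerivAt t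
    ((hasDerivAt_id t).prodMk (hasDerivAt_const t x))
  exact h.deriv

/-- Time and space derivatives of a `C²` map commute. -/
theorem hasDerivAt_fderiv_apply {φ : ℝ → E → F}
    (hφ : ContDiff ℝ 2 (Function.uncurry φ)) (t : ℝ) (x v : E) :
    HasDerivAt (fun s => fderiv ℝ (φ s) x v)
      (fderiv ℝ (fun y => deriv (fun s => φ s y) t) x v) t := by
  have hd : Differentiable ℝ (Function.uncurry φ) := hφ.differentiable two_ne_zero
  have hd2 : HasFDerivAt (fderiv ℝ (Function.uncurry φ))
      (fderiv ℝ (fderiv ℝ (Function.uncurry φ)) (t, x)) (t, x) :=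
    ((hφ.fderiv_right (m := 1) (by norm_num)).differentiable one_ne_zero _).hasFDerivAt
  have hsymm := hφ.contDiffAt.isSymmSndFDerivAt (x := (t, x)) (by simp)
  have hcurve : HasDerivAt (fun s : ℝ => (s, x)) ((1 : ℝ), (0 : E)) t :=
    (hasDerivAt_id t).prodMk (hasDerivAt_const t x)
  have htime : HasDerivAt (fun s => fderiv ℝ (Function.uncurry φ) (s, x) (0, v))
      (fderiv ℝ (fderiv ℝ (Function.uncurry φ)) (t, x) (1, 0) (0, v)) t :=
    (ContinuousLinearMap.apply ℝ F ((0, v) : ℝ × E)).hasFDerivAt.comp_hasDerivAt t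
      (hd2.comp_hasDerivAt t hcurve)
  have hspace : fderiv ℝ (fun y => fderiv ℝ (Function.uncurry φ) (t, y) (1, 0)) x v =
      fderiv ℝ (fderiv ℝ (Function.uncurry φ)) (t, x) (0, v) (1, 0) := by
    have h := (ContinuousLinearMap.apply ℝ F ((1, 0) : ℝ × E)).hasFDerivAt.comp x
      (hd2.comp x (hasFDerivAt_prodMk_right t x))
    exact DFunLike.congr_fun h.fderiv v
  simp only [fderiv_eq_fderiv_uncurry hd, deriv_eq_fderiv_uncurry hd]
  rw [hspace, hsymm.eq]
  exact htime

end PartialDerivatives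

/-- The Jacobian matrix of a composition is the product of the Jacobian matrices. -/
theorem jac_comp {n : ℕ} {f g : En n → En n} {x : En n}
    (hf : DifferentiableAt ℝ f (g x)) (hg : DifferentiableAt ℝ g x) :
    jac (fun y => f (g y)) x = jac f (g x) * jac g x := by
  ext i j
  have hv (w : En n) : w = ∑ k, w k • ee k := by
    ext l
    simp [ee, Finset.sum_apply, Pi.single_apply]
  rw [Matrix.mul_apply]
  unfold jac
  rw [fderiv_fun_comp x hf hg, ContinuousLinearMap.comp_apply]
  conv_lhs => rw [hv (fderiv ℝ g x (ee j))]
  simp [map_sum, mul_comm]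

/-- Liouville's formula: `∂ₜ det Dφ = (div u)∘φ · det Dφ` along the flow
of a time-dependent vector field. -/
theorem liouville_jacobian_formula
    (n : ℕ) (hn : 1 ≤ n)
    (φ u : ℝ → En n → En n)
    (hφ : ContDiff ℝ ∞ (Function.uncurry φ))
    (hu : ContDiff ℝ ∞ (Function.uncurry u))
    (hflow : ∀ t x, deriv (fun s => φ s x) t = u t (φ t x)) :
    ∀ t x, deriv (fun s => (jac (φ s) x).det) t
      = dvg (u t) (φ t x) * (jac (φ t) x).det := by
  intro t x
  have hφt : Differentiable ℝ (φ t) :=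
    (hφ.comp (contDiff_prodMk_right t)).differentiable (by simp)
  have hut : Differentiable ℝ (u t) :=
    (hu.comp (contDiff_prodMk_right t)).differentiable (by simp)
  have hdet : HasDerivAt (fun s => (jac (φ s) x).det)
      ((jac (u t) (φ t x)).trace * (jac (φ t) x).det) t := by
    refine hasDerivAt_det_of_linear fun i j => ?_
    have h := hasDerivAt_fderiv_apply (hφ.of_le (by norm_cast)) t x (ee j)
    simp only [hflow] at h
    have hi := (EuclideanSpace.proj (𝕜 := ℝ) i).hasFDerivAt.comp_hasDerivAt t h
    rw [← jac_comp (hut _) (hφt x)]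
    exact hi
  exact hdet.deriv
end
end

section
/- Let (X, μ) be a measure space. Let ρ : ℝ² × X → ℝ with ρ > 0 and θ : ℝ² × X → ℝ be such that (s,t) ↦ ρ(s,t,x) and (s,t) ↦ θ(s,t,x) admit partial derivatives ∂ₛ and ∂ₜ for each x, and set ψ(s,t,x) := √(ρ(s,t,x)) exp(i θ(s,t,x)/2). Fix (s,t) and assume the functions |∂ₛρ ∂ₜθ|, |∂ₜρ ∂ₛθ|, (∂ₛρ)(∂ₜρ)/ρ and (∂ₛθ)(∂ₜθ)ρ are μ-integrable there. Then Im ∫_X conj(∂ₛψ) · ∂ₜψ dμ = (1/4) ∫_X ( ∂ₛρ · ∂ₜθ − ∂ₛθ · ∂ₜρ ) dμ; i.e., the pullback under the Madelung transform of the L²(μ,ℂ) symplectic form Im⟨·,·⟩ is one quarter of the canonical pairing ∫(ρ̇₁θ̇₂ − θ̇₁ρ̇₂)dμ. -/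
noncomputable section

open MeasureTheory Complex
open scoped ContDiff RealInnerProductSpace

/-- Derivative of the Madelung transform `√r · exp(i q / 2)` along a curve `(r, q)`. -/
theorem hasDerivAt_madelung {r q : ℝ → ℝ} {r' q' a : ℝ} (hpos : 0 < r a)
    (hr : HasDerivAt r r' a) (hq : HasDerivAt q q' a) :
    HasDerivAt (fun u => (Real.sqrt (r u) : ℂ) * Complex.exp (Complex.I * (q u : ℂ) / 2))
      (((r' / (2 * Real.sqrt (r a)) : ℝ) + Complex.I * (Real.sqrt (r a) * q' / 2 : ℝ))
        * Complex.exp (Complex.I * (q a : ℂ) / 2)) a := by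
  have h1 := (hr.sqrt hpos.ne').ofReal_comp
  have h2 := ((hq.ofReal_comp.const_mul Complex.I).div_const 2).cexp
  refine (h1.mul h2).congr_deriv ?_
  push_cast
  ring

/-- The unit phase cancels in the Hermitian product of two tangent vectors at a Madelung
transform. -/
theorem conj_mul_madelung {r : ℝ} (hpos : 0 < r) (q r₁ q₁ r₂ q₂ : ℝ) :
    (starRingEnd ℂ) (((r₁ / (2 * Real.sqrt r) : ℝ) + Complex.I * (Real.sqrt r * q₁ / 2 : ℝ))
        * Complex.exp (Complex.I * (q : ℂ) / 2))
      * (((r₂ / (2 * Real.sqrt r) : ℝ) + Complex.I * (Real.sqrt r * q₂ / 2 : ℝ))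
        * Complex.exp (Complex.I * (q : ℂ) / 2))
      = ((1 / 4 * (r₁ * r₂ / r + q₁ * q₂ * r) : ℝ) : ℂ)
        + ((1 / 4 * (r₁ * q₂ - q₁ * r₂) : ℝ) : ℂ) * Complex.I := by
  have hexp : (starRingEnd ℂ) (Complex.exp (Complex.I * (q : ℂ) / 2))
      * Complex.exp (Complex.I * (q : ℂ) / 2) = 1 := by
    rw [← Complex.exp_conj, ← Complex.exp_add]
    have h2 : (starRingEnd ℂ) 2 = 2 := Complex.conj_ofNat 2
    simp [neg_div, h2]
  obtain ⟨w, hw, rfl⟩ : ∃ w : ℝ, 0 < w ∧ w ^ 2 = r :=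
    ⟨Real.sqrt r, Real.sqrt_pos.2 hpos, Real.sq_sqrt hpos.le⟩
  have hw0 : (w : ℂ) ≠ 0 := by exact_mod_cast hw.ne'
  rw [map_mul, mul_mul_mul_comm, hexp, mul_one, Real.sqrt_sq hw.le]
  simp only [map_add, map_mul, Complex.conj_ofReal, Complex.conj_I]
  push_cast
  field_simp
  ring_nf
  simp only [Complex.I_sq]
  ring

/-- If the real part `f` is integrable, the imaginary part of `∫ (f + g i)` is `∫ g`, whether or
not `g` is integrable. -/
theorem im_integral_ofReal_add_ofReal_mul_I {X : Type*} [MeasurableSpace X] {μ : Measure X}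
    {f : X → ℝ} (hf : Integrable f μ) (g : X → ℝ) :
    (∫ x, ((f x : ℂ) + (g x : ℂ) * Complex.I) ∂μ).im = ∫ x, g x ∂μ := by
  by_cases hg : Integrable g μ
  · rw [integral_add hf.ofReal (hg.ofReal.mul_const _), integral_mul_const,
      integral_complex_ofReal, integral_complex_ofReal]
    simp
  · have hfg : ¬ Integrable (fun x => (f x : ℂ) + (g x : ℂ) * Complex.I) μ := fun h =>
      hg (by simpa using h.im)
    rw [integral_undef hfg, integral_undef hg, Complex.zero_im]

/-- the Madelung transform pulls back the `L²(μ,ℂ)` symplectic form to one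
quarter of the canonical symplectic pairing on the cotangent bundle of densities. -/
theorem madelung_symplectomorphism
    {X : Type*} [MeasurableSpace X] (μ : Measure X)
    (ρ θ : ℝ → ℝ → X → ℝ) (hρpos : ∀ s t x, 0 < ρ s t x)
    (hρs : ∀ t x, Differentiable ℝ (fun a => ρ a t x))
    (hρt : ∀ s x, Differentiable ℝ (fun b => ρ s b x))
    (hθs : ∀ t x, Differentiable ℝ (fun a => θ a t x))
    (hθt : ∀ s x, Differentiable ℝ (fun b => θ s b x))
    (ψ : ℝ → ℝ → X → ℂ)
    (hψ : ∀ s t x, ψ s t x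
      = (Real.sqrt (ρ s t x) : ℂ) * Complex.exp (Complex.I * (θ s t x : ℂ) / 2))
    (s t : ℝ)
    (hi1 : Integrable (fun x => |deriv (fun a => ρ a t x) s * deriv (fun b => θ s b x) t|) μ)
    (hi2 : Integrable (fun x => |deriv (fun b => ρ s b x) t * deriv (fun a => θ a t x) s|) μ)
    (hi3 : Integrable
      (fun x => deriv (fun a => ρ a t x) s * deriv (fun b => ρ s b x) t / ρ s t x) μ)
    (hi4 : Integrable
      (fun x => deriv (fun a => θ a t x) s * deriv (fun b => θ s b x) t * ρ s t x) μ) :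
    (∫ x, (starRingEnd ℂ) (deriv (fun a => ψ a t x) s) * deriv (fun b => ψ s b x) t ∂μ).im
      = (1 / 4) * ∫ x, (deriv (fun a => ρ a t x) s * deriv (fun b => θ s b x) t
          - deriv (fun a => θ a t x) s * deriv (fun b => ρ s b x) t) ∂μ := by
  have hprod : ∀ x, (starRingEnd ℂ) (deriv (fun a => ψ a t x) s) * deriv (fun b => ψ s b x) t
      = ((1 / 4 * (deriv (fun a => ρ a t x) s * deriv (fun b => ρ s b x) t / ρ s t x
          + deriv (fun a => θ a t x) s * deriv (fun b => θ s b x) t * ρ s t x) : ℝ) : ℂ)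
        + ((1 / 4 * (deriv (fun a => ρ a t x) s * deriv (fun b => θ s b x) t
          - deriv (fun a => θ a t x) s * deriv (fun b => ρ s b x) t) : ℝ) : ℂ) * Complex.I := by
    intro x
    have hs := hasDerivAt_madelung (hρpos s t x) (hρs t x s).hasDerivAt (hθs t x s).hasDerivAt
    have ht := hasDerivAt_madelung (hρpos s t x) (hρt s x t).hasDerivAt (hθt s x t).hasDerivAt
    simp only [hψ]
    rw [hs.deriv, ht.deriv]
    exact conj_mul_madelung (hρpos s t x) _ _ _ _ _
  simp only [hprod]
  rw [← integral_const_mul]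
  exact im_integral_ofReal_add_ofReal_mul_I ((hi3.add hi4).const_mul (1 / 4)) _
end
end

section
/- Let φ : ℝ × ℝ → ℝ be smooth with φ(t, x+1) = φ(t,x) + 1 and ∂ₓφ(t,x) > 0 for all (t,x), and let α : ℝ × ℝ → ℝ be smooth with α(t, x+1) = α(t,x). Let u, σ : ℝ × ℝ → ℝ be smooth, 1-periodic in the spatial variable, and satisfy u(t, φ(t,x)) = ∂ₜφ(t,x) and σ(t, φ(t,x)) = ∂ₜα(t,x) for all (t,x). Define ψ(t,x) := √(∂ₓφ(t,x)) · exp(i α(t,x)/2). Then for every t, ∫₀¹ |∂ₜψ(t,x)|² dx = (1/4) ∫₀¹ ( (∂ₓu(t,y))² + σ(t,y)² ) dy. -/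
noncomputable section

open MeasureTheory Complex
open scoped ContDiff RealInnerProductSpace

theorem hasDerivAt_comp_prodMk_left {E : Type*} [NormedAddCommGroup E] [NormedSpace ℝ E]
    {G : ℝ × ℝ → E} (hG : Differentiable ℝ G) (s y : ℝ) :
    HasDerivAt (fun r => G (r, y)) (fderiv ℝ G (s, y) (1, 0)) s :=
  HasFDerivAt.comp_hasDerivAt (f := fun r : ℝ => (r, y)) s (hG (s, y)).hasFDerivAt
    ((hasDerivAt_id s).prodMk (hasDerivAt_const s y))

theorem hasDerivAt_comp_prodMk_right {E : Type*} [NormedAddCommGroup E] [NormedSpace ℝ E]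
    {G : ℝ × ℝ → E} (hG : Differentiable ℝ G) (s y : ℝ) :
    HasDerivAt (fun r => G (s, r)) (fderiv ℝ G (s, y) (0, 1)) y :=
  HasFDerivAt.comp_hasDerivAt (f := fun r : ℝ => (s, r)) y (hG (s, y)).hasFDerivAt
    ((hasDerivAt_const y s).prodMk (hasDerivAt_id y))

/-- Mixed partial derivatives of a `C²` function of two real variables commute. -/
theorem hasDerivAt_deriv_of_contDiff_uncurry {f : ℝ → ℝ → ℝ}
    (hf : ContDiff ℝ 2 (Function.uncurry f)) (t x : ℝ) :
    HasDerivAt (fun s => deriv (f s) x) (deriv (fun y => deriv (fun s => f s y) t) x) t := by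
  have hd : Differentiable ℝ (Function.uncurry f) := hf.differentiable (by norm_num)
  have hd2 : Differentiable ℝ (fderiv ℝ (Function.uncurry f)) :=
    (hf.fderiv_right (m := 1) (by norm_num)).differentiable (by norm_num)
  have h1 : ∀ s y, deriv (f s) y = fderiv ℝ (Function.uncurry f) (s, y) (0, 1) := fun s y =>
    (hasDerivAt_comp_prodMk_right hd s y).deriv
  have h2 : ∀ s y, deriv (fun r => f r y) s = fderiv ℝ (Function.uncurry f) (s, y) (1, 0) :=
    fun s y => (hasDerivAt_comp_prodMk_left hd s y).deriv
  have h3 := (hasDerivAt_comp_prodMk_left hd2 t x).clm_apply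
    (hasDerivAt_const t ((0, 1) : ℝ × ℝ))
  have h4 := (hasDerivAt_comp_prodMk_right hd2 t x).clm_apply
    (hasDerivAt_const x ((1, 0) : ℝ × ℝ))
  rw [map_zero, add_zero] at h3 h4
  have hsymm : IsSymmSndFDerivAt ℝ (Function.uncurry f) (t, x) :=
    hf.contDiffAt.isSymmSndFDerivAt (by simp)
  simp only [h1, h2]
  rw [h4.deriv, hsymm.eq (0, 1) (1, 0)]
  exact h3

/-- The squared speed of the curve `√ρ · exp (i a / 2)` in the complex plane. -/
theorem norm_sq_deriv_sqrt_mul_exp {ρ a : ℝ → ℝ} {ρ' a' t : ℝ} (hρ : HasDerivAt ρ ρ' t)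
    (ha : HasDerivAt a a' t) (hpos : 0 < ρ t) :
    ‖deriv (fun s => (Real.sqrt (ρ s) : ℂ) * Complex.exp (Complex.I * (a s : ℂ) / 2)) t‖ ^ 2
      = (ρ' ^ 2 / ρ t + ρ t * a' ^ 2) / 4 := by
  have h1 := (hρ.sqrt hpos.ne').ofReal_comp
  have h2 := ((ha.ofReal_comp.const_mul Complex.I).div_const 2).cexp
  have hexp : ‖Complex.exp (Complex.I * (a t : ℂ) / 2)‖ = 1 := by
    rw [Complex.norm_exp]
    simp
  have hsq : Real.sqrt (ρ t) ^ 2 = ρ t := Real.sq_sqrt hpos.le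
  have hfac : deriv (fun s => (Real.sqrt (ρ s) : ℂ) * Complex.exp (Complex.I * (a s : ℂ) / 2)) t
      = Complex.exp (Complex.I * (a t : ℂ) / 2) *
        (⟨ρ' / (2 * Real.sqrt (ρ t)), Real.sqrt (ρ t) * a' / 2⟩ : ℂ) := by
    rw [(h1.fun_mul h2).deriv, Complex.mk_eq_add_mul_I]
    push_cast
    ring
  rw [hfac, norm_mul, hexp, one_mul, Complex.sq_norm, Complex.normSq_mk]
  calc _ = (ρ' ^ 2 / Real.sqrt (ρ t) ^ 2 + Real.sqrt (ρ t) ^ 2 * a' ^ 2) / 4 := by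
        field_simp
        ring
    _ = _ := by rw [hsq]

/-- Change of variables in a period integral by the lift of a circle map of degree one. -/
theorem intervalIntegral_comp_mul_deriv_of_degree_one {g η : ℝ → ℝ} (hg : Continuous g)
    (hgper : Function.Periodic g 1) (hη : ContDiff ℝ 1 η) (hηper : ∀ x, η (x + 1) = η x + 1) :
    ∫ x in (0 : ℝ)..1, g (η x) * deriv η x = ∫ y in (0 : ℝ)..1, g y := by
  have h := intervalIntegral.integral_comp_mul_deriv (a := 0) (b := 1) (g := g)
    (fun x _ => (hη.differentiable (by norm_num) x).hasDerivAt)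
    (hη.continuous_deriv le_rfl).continuousOn hg
  have h1 : η 1 = η 0 + 1 := by simpa using hηper 0
  simpa [Function.comp_def, h1] using h.trans
    (by rw [h1]; simpa using hgper.intervalIntegral_add_eq (η 0) 0)

/-- the map `(φ,α) ↦ √(∂ₓφ) e^{iα/2}` carries the right-invariant
`Ḣ¹ ⊕ L²` energy of the two-component Hunter–Saxton system to the `L²` energy of the
corresponding curve of wave functions. -/
theorem two_component_HS_isometry
    (φ : ℝ → ℝ → ℝ) (hφ : ContDiff ℝ ∞ (Function.uncurry φ))
    (hφper : ∀ t x, φ t (x + 1) = φ t x + 1)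
    (hφx : ∀ t x, 0 < deriv (φ t) x)
    (α : ℝ → ℝ → ℝ) (hα : ContDiff ℝ ∞ (Function.uncurry α))
    (hαper : ∀ t x, α t (x + 1) = α t x)
    (u σ : ℝ → ℝ → ℝ)
    (hu : ContDiff ℝ ∞ (Function.uncurry u)) (hσ : ContDiff ℝ ∞ (Function.uncurry σ))
    (huper : ∀ t x, u t (x + 1) = u t x) (hσper : ∀ t x, σ t (x + 1) = σ t x)
    (hudef : ∀ t x, u t (φ t x) = deriv (fun s => φ s x) t)
    (hσdef : ∀ t x, σ t (φ t x) = deriv (fun s => α s x) t)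
    (ψ : ℝ → ℝ → ℂ)
    (hψ : ∀ t x, ψ t x
      = (Real.sqrt (deriv (φ t) x) : ℂ) * Complex.exp (Complex.I * (α t x : ℂ) / 2)) :
    ∀ t, ∫ x in (0 : ℝ)..1, ‖deriv (fun s => ψ s x) t‖ ^ 2
      = (1 / 4) * ∫ y in (0 : ℝ)..1, ((deriv (u t) y) ^ 2 + (σ t y) ^ 2) := by
  intro t
  have hslice : ∀ {f : ℝ → ℝ → ℝ}, ContDiff ℝ ∞ (Function.uncurry f) → ContDiff ℝ ∞ (f t) :=
    fun hf => hf.comp (contDiff_const.prodMk contDiff_id)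
  have hut := hslice hu
  have hφt := hslice hφ
  have hspeed : ∀ x, ‖deriv (fun s => ψ s x) t‖ ^ 2
      = (1 / 4) * (((deriv (u t) (φ t x)) ^ 2 + (σ t (φ t x)) ^ 2) * deriv (φ t) x) := by
    intro x
    have hmixed : HasDerivAt (fun s => deriv (φ s) x)
        (deriv (u t) (φ t x) * deriv (φ t) x) t := by
      have h := hasDerivAt_deriv_of_contDiff_uncurry
        (by exact_mod_cast contDiff_infty.mp hφ 2) t x
      simp only [← hudef] at h
      rwa [show (fun y => u t (φ t y)) = u t ∘ φ t from rfl,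
        deriv_comp x (hut.differentiable (by simp) _) (hφt.differentiable (by simp) x)] at h
    have hphase : HasDerivAt (fun s => α s x) (σ t (φ t x)) t := by
      rw [hσdef]
      exact ((hα.comp (contDiff_id.prodMk contDiff_const)).differentiable
        (by simp) t).hasDerivAt
    simp only [hψ]
    rw [norm_sq_deriv_sqrt_mul_exp hmixed hphase (hφx t x)]
    have := (hφx t x).ne'
    field_simp
  have hderivper : Function.Periodic (deriv (u t)) 1 := fun y => by
    rw [← deriv_comp_add_const, funext (huper t)]
  simp only [hspeed]
  rw [intervalIntegral.integral_const_mul, intervalIntegral_comp_mul_deriv_of_degree_one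
    (g := fun y => (deriv (u t) y) ^ 2 + (σ t y) ^ 2)
    (((hut.continuous_deriv (by simp)).pow 2).add ((hslice hσ).continuous.pow 2))
    (fun y => by simp only [hderivper y, hσper t y]) (hφt.of_le (by simp)) (hφper t)]
end
end

section
/- Let u : ℝ × ℝ → ℝ be smooth and satisfy ∂ₜ∂ₓ²u + 2 ∂ₓu · ∂ₓ²u + u · ∂ₓ³u = 0 at every point. Let φ : ℝ × ℝ → ℝ be smooth with ∂ₜφ(t,x) = u(t, φ(t,x)) and ∂ₓφ(t,x) > 0 for all (t,x). Then the function f := √(∂ₓφ) satisfies a great-circle equation: there exists a function c : ℝ → ℝ such that ∂ₜ²f(t,x) = c(t) · f(t,x) for all (t,x); explicitly, c(t) = (1/2)( ∂ₜ∂ₓu + u ∂ₓ²u + (1/2)(∂ₓu)² )(t, φ(t,x)), and this quantity is independent of x. -/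
noncomputable section

open MeasureTheory Complex
open scoped ContDiff RealInnerProductSpace

section PartialDerivatives

variable {g : ℝ → ℝ → ℝ}

theorem hasDerivAt_comp_curve (hg : ContDiff ℝ ∞ (Function.uncurry g)) {a b : ℝ → ℝ}
    {a' b' r : ℝ} (ha : HasDerivAt a a' r) (hb : HasDerivAt b b' r) :
    HasDerivAt (fun s => g (a s) (b s))
      (fderiv ℝ (Function.uncurry g) (a r, b r) (a', b')) r :=
  HasFDerivAt.comp_hasDerivAt (f := fun s => (a s, b s)) r
    ((hg.differentiable (by simp)) (a r, b r)).hasFDerivAt (ha.prodMk hb)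

theorem hasDerivAt_snd (hg : ContDiff ℝ ∞ (Function.uncurry g)) (t x : ℝ) :
    HasDerivAt (g t) (fderiv ℝ (Function.uncurry g) (t, x) (0, 1)) x :=
  hasDerivAt_comp_curve hg (hasDerivAt_const x t) (hasDerivAt_id x)

theorem hasDerivAt_fst (hg : ContDiff ℝ ∞ (Function.uncurry g)) (t x : ℝ) :
    HasDerivAt (fun s => g s x) (fderiv ℝ (Function.uncurry g) (t, x) (1, 0)) t :=
  hasDerivAt_comp_curve hg (hasDerivAt_id t) (hasDerivAt_const t x)

theorem contDiff_deriv_snd (hg : ContDiff ℝ ∞ (Function.uncurry g)) :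
    ContDiff ℝ ∞ (Function.uncurry fun t x => deriv (g t) x) := by
  have h : (Function.uncurry fun t x => deriv (g t) x) =
      fun p => fderiv ℝ (Function.uncurry g) p (0, 1) :=
    funext fun p => (hasDerivAt_snd hg p.1 p.2).deriv
  rw [h]
  exact (hg.fderiv_right (by simp)).clm_apply contDiff_const

theorem contDiff_deriv_fst (hg : ContDiff ℝ ∞ (Function.uncurry g)) :
    ContDiff ℝ ∞ (Function.uncurry fun t x => deriv (fun s => g s x) t) := by
  have h : (Function.uncurry fun t x => deriv (fun s => g s x) t) =
      fun p => fderiv ℝ (Function.uncurry g) p (1, 0) :=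
    funext fun p => (hasDerivAt_fst hg p.1 p.2).deriv
  rw [h]
  exact (hg.fderiv_right (by simp)).clm_apply contDiff_const

theorem hasDerivAt_fderiv_comp_curve {F : ℝ × ℝ → ℝ} (hF : ContDiff ℝ ∞ F) {γ : ℝ → ℝ × ℝ}
    {γ' : ℝ × ℝ} {r : ℝ} (hγ : HasDerivAt γ γ' r) (v : ℝ × ℝ) :
    HasDerivAt (fun s => fderiv ℝ F (γ s) v) (fderiv ℝ (fderiv ℝ F) (γ r) γ' v) r := by
  have hd : DifferentiableAt ℝ (fderiv ℝ F) (γ r) :=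
    (hF.fderiv_right (m := ∞) (by simp)).differentiable (by simp) _
  have h : HasDerivAt (fun s => fderiv ℝ F (γ s)) (fderiv ℝ (fderiv ℝ F) (γ r) γ') r :=
    HasFDerivAt.comp_hasDerivAt (f := γ) r hd.hasFDerivAt hγ
  exact (h.clm_apply (hasDerivAt_const r v)).congr_deriv (by rw [map_zero, add_zero])

theorem deriv_deriv_comm (hg : ContDiff ℝ ∞ (Function.uncurry g)) (t x : ℝ) :
    deriv (fun s => deriv (g s) x) t = deriv (fun y => deriv (fun s => g s y) t) x := by
  have hsymm : IsSymmSndFDerivAt ℝ (Function.uncurry g) (t, x) :=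
    hg.contDiffAt.isSymmSndFDerivAt
      (by rw [minSmoothness_of_isRCLikeNormedField]; exact WithTop.coe_le_coe.2 (le_top (a := 2)))
  simp_rw [(hasDerivAt_snd hg _ _).deriv, (hasDerivAt_fst hg _ _).deriv]
  rw [(hasDerivAt_fderiv_comp_curve hg
      ((hasDerivAt_id' t).prodMk (hasDerivAt_const t x)) (0, 1)).deriv,
    (hasDerivAt_fderiv_comp_curve hg
      ((hasDerivAt_const x t).prodMk (hasDerivAt_id' x)) (1, 0)).deriv]
  exact hsymm _ _

theorem hasDerivAt_along_curve (hg : ContDiff ℝ ∞ (Function.uncurry g)) {γ : ℝ → ℝ}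
    {v t : ℝ} (hγ : HasDerivAt γ v t) :
    HasDerivAt (fun s => g s (γ s))
      (deriv (fun s => g s (γ t)) t + v * deriv (g t) (γ t)) t := by
  have h := hasDerivAt_comp_curve hg (hasDerivAt_id t) hγ
  have hv : ((1, v) : ℝ × ℝ) = (1, 0) + v • (0, 1) := by simp
  rw [hv, map_add, map_smul, smul_eq_mul] at h
  rw [(hasDerivAt_fst hg t (γ t)).deriv, (hasDerivAt_snd hg t (γ t)).deriv]
  exact h

end PartialDerivatives

/-- The multiplier is the same at every point of space, because its spatial derivative is the
left-hand side of the equation. -/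
theorem muCH_multiplier_const
    {u : ℝ → ℝ → ℝ} (hu : ContDiff ℝ ∞ (Function.uncurry u))
    (hPDE : ∀ t x, deriv (fun s => deriv (deriv (u s)) x) t
        + 2 * deriv (u t) x * deriv (deriv (u t)) x
        + u t x * deriv (deriv (deriv (u t))) x = 0) (t x y : ℝ) :
    deriv (fun s => deriv (u s) x) t + u t x * deriv (deriv (u t)) x
        + (1 / 2) * (deriv (u t) x) ^ 2
      = deriv (fun s => deriv (u s) y) t + u t y * deriv (deriv (u t)) y
        + (1 / 2) * (deriv (u t) y) ^ 2 := by
  have hu₁ := contDiff_deriv_snd hu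
  have hu₂ := contDiff_deriv_snd hu₁
  have hF (z : ℝ) : HasDerivAt (fun z => deriv (fun s => deriv (u s) z) t
      + u t z * deriv (deriv (u t)) z + (1 / 2) * (deriv (u t) z) ^ 2) 0 z := by
    have h₀ := (hasDerivAt_snd hu t z).differentiableAt.hasDerivAt
    have h₁ := (hasDerivAt_snd hu₁ t z).differentiableAt.hasDerivAt
    have h₂ := (hasDerivAt_snd hu₂ t z).differentiableAt.hasDerivAt
    have h₃ := (hasDerivAt_snd (contDiff_deriv_fst hu₁) t z).differentiableAt.hasDerivAt
    rw [← deriv_deriv_comm hu₁] at h₃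
    refine ((h₃.add (h₀.mul h₂)).add ((h₁.pow 2).const_mul (1 / 2))).congr_deriv ?_
    have := hPDE t z
    push_cast
    linear_combination this
  exact is_const_of_deriv_eq_zero (fun z => (hF z).differentiableAt) (fun z => (hF z).deriv) x y

/-- The square root of the spatial Jacobian of a flow grows at half the rate of the spatial
derivative of the velocity. -/
theorem hasDerivAt_sqrt_deriv_flow
    {u φ : ℝ → ℝ → ℝ} (hu : ContDiff ℝ ∞ (Function.uncurry u))
    (hφ : ContDiff ℝ ∞ (Function.uncurry φ))
    (hflow : ∀ t x, deriv (fun s => φ s x) t = u t (φ t x))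
    (hφx : ∀ t x, 0 < deriv (φ t) x) (t x : ℝ) :
    HasDerivAt (fun r => Real.sqrt (deriv (φ r) x))
      ((1 / 2) * deriv (u t) (φ t x) * Real.sqrt (deriv (φ t) x)) t := by
  have hw := (hasDerivAt_fst (contDiff_deriv_snd hφ) t x).differentiableAt.hasDerivAt
  have hux := (hasDerivAt_snd hu t (φ t x)).differentiableAt.hasDerivAt
  have hφ' := (hasDerivAt_snd hφ t x).differentiableAt.hasDerivAt
  have hcomp : deriv (fun y => u t (φ t y)) x = deriv (u t) (φ t x) * deriv (φ t) x :=
    (hux.comp x hφ').deriv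
  rw [deriv_deriv_comm hφ] at hw
  simp_rw [hflow] at hw
  rw [hcomp] at hw
  refine (hw.sqrt (hφx t x).ne').congr_deriv ?_
  have hpos := Real.sqrt_pos.2 (hφx t x)
  have hsq := Real.sq_sqrt (hφx t x).le
  field_simp
  linear_combination -(deriv (u t) (φ t x)) * hsq

/-- horizontal μCH solutions describe great circles: `f = √(∂ₓφ)` satisfies
`∂ₜ²f = c(t) f` with the explicit multiplier `c`. -/
theorem muCH_great_circle
    (u : ℝ → ℝ → ℝ) (hu : ContDiff ℝ ∞ (Function.uncurry u))
    (hPDE : ∀ t x, deriv (fun s => deriv (deriv (u s)) x) t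
        + 2 * deriv (u t) x * deriv (deriv (u t)) x
        + u t x * deriv (deriv (deriv (u t))) x = 0)
    (φ : ℝ → ℝ → ℝ) (hφ : ContDiff ℝ ∞ (Function.uncurry φ))
    (hflow : ∀ t x, deriv (fun s => φ s x) t = u t (φ t x))
    (hφx : ∀ t x, 0 < deriv (φ t) x) :
    ∃ c : ℝ → ℝ,
      (∀ t x, deriv (fun s => deriv (fun r => Real.sqrt (deriv (φ r) x)) s) t
          = c t * Real.sqrt (deriv (φ t) x))
      ∧ (∀ t x, c t = (1 / 2) * (deriv (fun s => deriv (u s) (φ t x)) t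
          + u t (φ t x) * deriv (deriv (u t)) (φ t x)
          + (1 / 2) * (deriv (u t) (φ t x)) ^ 2)) := by
  have hu₁ := contDiff_deriv_snd hu
  refine ⟨fun t => (1 / 2) * (deriv (fun s => deriv (u s) 0) t + u t 0 * deriv (deriv (u t)) 0
    + (1 / 2) * (deriv (u t) 0) ^ 2), fun t x => ?_, fun t x =>
      congrArg ((1 / 2 : ℝ) * ·) (muCH_multiplier_const hu hPDE t 0 (φ t x))⟩
  have hf := hasDerivAt_sqrt_deriv_flow hu hφ hflow hφx
  have hγ := (hasDerivAt_fst hφ t x).differentiableAt.hasDerivAt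
  rw [hflow] at hγ
  simp_rw [(hf _ x).deriv]
  refine (((hasDerivAt_along_curve hu₁ hγ).const_mul (1 / 2)).mul (hf t x)).deriv.trans ?_
  rw [muCH_multiplier_const hu hPDE t 0 (φ t x)]
  ring
end
end
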